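/- arXiv:2212.05844 — 3 statements merged into one kernel-verified Lean document; each statement's English description precedes it below -/
import Mathlib

section
/- (Geometric Lemma) For every integer d ≥ 2 there exist a real ε_u > 0, a finite set Λ ⊆ 𝕊^{d−1} ∩ ℚ^d of rational unit vectors, and, for each k ∈ Λ, a function γ_{(k)} : B_{ε_u}(Id) → ℝ that is C^∞-smooth and strictly positive on B_{ε_u}(Id), such that for every symmetric d × d real matrix S with ‖S − Id‖ < ε_u one has the identity S = Σ_{k ∈ Λ} γ_{(k)}(S)² · (k ⊗ k). -/
open Real

noncomputable section

/-- The Frobenius norm of a `d × d` real matrix (represented as `Fin d → Fin d → ℝ`). -/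
def frobNorm {d : ℕ} (S : Fin d → Fin d → ℝ) : ℝ :=
  Real.sqrt (∑ i, ∑ j, (S i j) ^ 2)

/-- A matrix is symmetric. -/
def IsSymmMat {d : ℕ} (S : Fin d → Fin d → ℝ) : Prop := ∀ i j, S i j = S j i

/-- The identity matrix. -/
def idMat (d : ℕ) : Fin d → Fin d → ℝ := fun i j => if i = j then 1 else 0

/-- The open ball of radius `ε` around the identity in the space of symmetric
`d × d` matrices, with respect to the Frobenius norm. -/
def symmBall (d : ℕ) (ε : ℝ) : Set (Fin d → Fin d → ℝ) :=
  {S | IsSymmMat S ∧ frobNorm (fun i j => S i j - idMat d i j) < ε}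

/-- The unit vector `eᵢ` if `i = j`, and `(3/5) eᵢ ± (4/5) eⱼ` otherwise. -/
def geomDir {d : ℕ} (x : Fin d × Fin d × Bool) : Fin d → ℝ := fun p =>
  if x.1 = x.2.1 then (if x.1 = p then 1 else 0)
  else 3 / 5 * (if x.1 = p then 1 else 0)
    + (if x.2.2 then 1 else -1) * (4 / 5) * (if x.2.1 = p then 1 else 0)

/-- The coefficient of `geomDir x ⊗ geomDir x` in the decomposition of `S`. -/
def geomCoeff {d : ℕ} (e : ℝ) (x : Fin d × Fin d × Bool) (S : Fin d → Fin d → ℝ) : ℝ :=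
  if x.1 = x.2.1 then (S x.1 x.2.1 + 2 * e - 1 / 2) / 2
  else e + (if x.2.2 then 1 else -1) * (25 / 48) * S x.1 x.2.1

lemma sum_sq_geomDir {d : ℕ} (x : Fin d × Fin d × Bool) : ∑ p, geomDir x p ^ 2 = 1 := by
  obtain ⟨i, j, s⟩ := x
  by_cases h : i = j
  · simp [geomDir, h]
  · have key : ∀ p, geomDir (i, j, s) p ^ 2
        = 9 / 25 * (if i = p then 1 else 0) + 16 / 25 * (if j = p then 1 else 0) := by
      intro p
      by_cases hi : i = p
      · subst hi
        have hj : ¬ j = i := fun hj => h hj.symm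
        simp [geomDir, h, hj]
        norm_num
      · by_cases hj : j = p <;> cases s <;> simp [geomDir, h, hi, hj] <;> norm_num
    simp only [key, Finset.sum_add_distrib, ← Finset.mul_sum]
    simp
    norm_num

lemma geomDir_rational {d : ℕ} (x : Fin d × Fin d × Bool) (p : Fin d) :
    ∃ q : ℚ, geomDir x p = (q : ℝ) := by
  refine ⟨if x.1 = x.2.1 then (if x.1 = p then 1 else 0)
    else 3 / 5 * (if x.1 = p then 1 else 0)
      + (if x.2.2 then 1 else -1) * (4 / 5) * (if x.2.1 = p then 1 else 0), ?_⟩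
  unfold geomDir
  split_ifs <;> norm_num

lemma sum_geomCoeff_mul_geomDir {d : ℕ} {e : ℝ} (he : d * e = 1 / 4) {S : Fin d → Fin d → ℝ}
    (hS : IsSymmMat S) (p q : Fin d) :
    ∑ x, geomCoeff e x S * (geomDir x p * geomDir x q) = S p q := by
  have key : ∀ i j : Fin d,
      ∑ s, geomCoeff e (i, j, s) S * (geomDir (i, j, s) p * geomDir (i, j, s) q)
        = 18 / 25 * e * (if i = p then if i = q then 1 else 0 else 0)
          + 32 / 25 * e * (if j = p then if j = q then 1 else 0 else 0)
          + (if i = p then if j = q then S i j / 2 else 0 else 0)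
          + (if i = q then if j = p then S i j / 2 else 0 else 0)
          - (if i = j then if i = p then if i = q then 1 / 2 else 0 else 0 else 0) := by
    intro i j
    rw [Fintype.sum_bool]
    by_cases h : i = j
    · subst h
      by_cases hp : i = p <;> by_cases hq : i = q <;> simp [geomDir, geomCoeff, hp, hq]
        <;> simp_all <;> ring
    · simp only [geomDir, geomCoeff, h, if_false, if_true, Bool.false_eq_true]
      split_ifs <;> simp_all <;> ring
  simp only [Fintype.sum_prod_type, key, Finset.sum_add_distrib, Finset.sum_sub_distrib,
    ← Finset.mul_sum]
  have hpq := hS p q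
  by_cases h : p = q
  · subst h
    simp
    linear_combination 2 * he
  · simp [h]
    linarith

lemma abs_sub_idMat_lt {d : ℕ} {ε : ℝ} {S : Fin d → Fin d → ℝ} (hS : S ∈ symmBall d ε)
    (i j : Fin d) : |S i j - idMat d i j| < ε := by
  refine lt_of_le_of_lt (Real.abs_le_sqrt ?_) hS.2
  calc (S i j - idMat d i j) ^ 2 ≤ ∑ b, (S i b - idMat d i b) ^ 2 :=
        Finset.single_le_sum (f := fun b => (S i b - idMat d i b) ^ 2)
          (fun _ _ => sq_nonneg _) (Finset.mem_univ j)
    _ ≤ ∑ a, ∑ b, (S a b - idMat d a b) ^ 2 :=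
        Finset.single_le_sum (f := fun a => ∑ b, (S a b - idMat d a b) ^ 2)
          (fun _ _ => Finset.sum_nonneg fun _ _ => sq_nonneg _) (Finset.mem_univ i)

lemma geomCoeff_pos {d : ℕ} {e : ℝ} (he : 0 < e) (he' : e < 1 / 2) {S : Fin d → Fin d → ℝ}
    (hS : S ∈ symmBall d e) (x : Fin d × Fin d × Bool) : 0 < geomCoeff e x S := by
  obtain ⟨i, j, s⟩ := x
  have h := abs_lt.1 (abs_sub_idMat_lt hS i j)
  by_cases hij : i = j
  · simp only [geomCoeff, idMat, hij, if_true] at h ⊢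
    linarith [h.1]
  · simp only [geomCoeff, idMat, hij, if_false] at h ⊢
    cases s
    · simp only [Bool.false_eq_true, if_false]
      linarith [h.2]
    · simp only [if_true]
      linarith [h.1]

lemma contDiff_geomCoeff {d : ℕ} (e : ℝ) (x : Fin d × Fin d × Bool) :
    ContDiff ℝ (⊤ : ℕ∞) (geomCoeff e x) := by
  unfold geomCoeff
  split_ifs <;> fun_prop

/-- **Geometric Lemma.** For every `d ≥ 2` there exist `ε_u > 0`, a finite set
`Λ ⊆ 𝕊^{d-1} ∩ ℚ^d` of rational unit vectors and smooth positive functions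
`γ_{(k)} : B_{ε_u}(Id) → ℝ`, defined on the `ε_u`-ball around the identity in the space of
symmetric `d × d` matrices, such that `S = ∑_{k ∈ Λ} γ_{(k)}(S)² k ⊗ k` for every
symmetric `S` with `‖S - Id‖ < ε_u`. -/
theorem geometric_lemma (d : ℕ) (hd : 2 ≤ d) :
    ∃ εu : ℝ, 0 < εu ∧
      ∃ (Λ : Finset (Fin d → ℝ)) (γ : (Fin d → ℝ) → (Fin d → Fin d → ℝ) → ℝ),
        (∀ k ∈ Λ, (∑ i, (k i) ^ 2) = 1 ∧ ∀ i, ∃ q : ℚ, k i = (q : ℝ)) ∧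
        (∀ k ∈ Λ, ContDiffOn ℝ (⊤ : ℕ∞) (γ k) (symmBall d εu)) ∧
        (∀ k ∈ Λ, ∀ S ∈ symmBall d εu, 0 < γ k S) ∧
        (∀ S ∈ symmBall d εu, ∀ i j, S i j = ∑ k ∈ Λ, (γ k S) ^ 2 * (k i * k j)) := by
  classical
  have hd' : (2 : ℝ) ≤ d := by exact_mod_cast hd
  obtain ⟨e, he⟩ : ∃ e : ℝ, d * e = 1 / 4 := ⟨1 / (4 * d), by field_simp⟩
  have he0 : 0 < e := by
    by_contra! h
    nlinarith
  have he1 : e < 1 / 2 := by nlinarith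
  have hpos : ∀ k ∈ Finset.univ.image (geomDir (d := d)), ∀ S ∈ symmBall d e,
      0 < ∑ x with geomDir x = k, geomCoeff e x S := by
    intro k hk S hS
    obtain ⟨x, -, hx⟩ := Finset.mem_image.1 hk
    exact Finset.sum_pos (fun y _ => geomCoeff_pos he0 he1 hS y) ⟨x, by simpa using hx⟩
  refine ⟨e, he0, Finset.univ.image geomDir,
    fun k S => √(∑ x with geomDir x = k, geomCoeff e x S), ?_, ?_, ?_, ?_⟩
  · intro k hk
    obtain ⟨x, -, rfl⟩ := Finset.mem_image.1 hk
    exact ⟨sum_sq_geomDir x, geomDir_rational x⟩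
  · intro k hk
    exact ContDiffOn.sqrt (ContDiff.sum fun x _ => contDiff_geomCoeff e x).contDiffOn
      fun S hS => (hpos k hk S hS).ne'
  · exact fun k hk S hS => Real.sqrt_pos.2 (hpos k hk S hS)
  · intro S hS i j
    rw [← sum_geomCoeff_mul_geomDir he hS.1 i j,
      ← Finset.sum_fiberwise_of_maps_to (g := geomDir) (t := Finset.univ.image geomDir)
        fun x hx => Finset.mem_image_of_mem _ hx]
    refine Finset.sum_congr rfl fun k hk => ?_
    rw [Real.sq_sqrt (hpos k hk S hS).le, Finset.sum_mul]
    refine Finset.sum_congr rfl fun x hx => ?_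
    rw [(Finset.mem_filter.1 hx).2]

end
end

section
/- (Normalization of Mikado flows on the torus) Let d ≥ 2, let {k, k₁, …, k_{d−1}} be an orthonormal basis of ℝ^d with N_Λ k, N_Λ k₁, …, N_Λ k_{d−1} ∈ ℤ^d for some N_Λ ∈ ℕ, and let φ : ℝ^{d−1} → ℝ be continuous, (2πℤ)^{d−1}-periodic, and normalized so that (2π)^{−(d−1)} ∫_{[−π,π]^{d−1}} φ(y)² dy = 1. For λ ∈ ℕ₊ set φ_{(k)}(x) := φ(λ N_Λ k₁·x, …, λ N_Λ k_{d−1}·x), a well-defined function on 𝕋^d. Then the mean square of φ_{(k)} over the torus equals one: (2π)^{−d} ∫_{𝕋^d} φ_{(k)}(x)² dx = 1; consequently the Mikado flow W_{(k)} := φ_{(k)} k satisfies (2π)^{−d} ∫_{𝕋^d} W_{(k)} ⊗ W_{(k)} dx = k ⊗ k. -/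
open Real MeasureTheory

noncomputable section

/-- Euclidean dot product on `ℝ^d`. -/
def dotProd {d : ℕ} (v w : Fin d → ℝ) : ℝ := ∑ i, v i * w i

/-- The fundamental domain `[-π,π]^n ⊆ ℝ^n` of the torus `𝕋^n`. -/
def fundDomain (n : ℕ) : Set (Fin n → ℝ) := Set.univ.pi fun _ => Set.Icc (-π) π

instance two_pi_pos_fact : Fact (0 < 2 * π) := ⟨two_pi_pos⟩

/-- The covering map `ℝ^ι → (ℝ/2πℤ)^ι`. -/
def torusMk (ι : Type*) (y : ι → ℝ) : ι → AddCircle (2 * π) := fun i => (y i : AddCircle (2 * π))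

theorem torusMk_surjective (ι : Type*) : Function.Surjective (torusMk ι) := fun t =>
  ⟨fun i => AddCircle.equivIoc (2 * π) (-π) (t i),
    funext fun _ => AddCircle.coe_equivIoc⟩

theorem measurePreserving_torusMk (n : ℕ) :
    MeasurePreserving (torusMk (Fin n)) (volume.restrict (fundDomain n)) volume := by
  have h1 : MeasurePreserving (fun x : ℝ => (x : AddCircle (2 * π)))
      (volume.restrict (Set.Icc (-π) π)) volume := by
    have h := AddCircle.measurePreserving_mk (2 * π) (-π)
    rw [show -π + 2 * π = π by ring] at h
    rwa [← Measure.restrict_congr_set Ioc_ae_eq_Icc]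
  have h2 := measurePreserving_pi (fun _ : Fin n => volume.restrict (Set.Icc (-π) π))
    (fun _ => (volume : Measure (AddCircle (2 * π)))) (fun _ => h1)
  rw [volume_pi, fundDomain, Measure.restrict_pi_pi, volume_pi]
  exact h2

/-- A continuous `2π`-periodic function of `n` variables descends to a measurable function on the
torus. -/
theorem exists_measurable_torus_descent {ι : Type*} [Fintype ι] {F : (ι → ℝ) → ℝ}
    (hF : Continuous F)
    (hper : ∀ (y : ι → ℝ) (n : ι → ℤ), F (fun i => y i + 2 * π * n i) = F y) :
    ∃ g : (ι → AddCircle (2 * π)) → ℝ, Measurable g ∧ ∀ y, g (torusMk ι y) = F y := by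
  refine ⟨fun t => F fun i => AddCircle.equivIoc (2 * π) (-π) (t i), ?_, fun y => ?_⟩
  · refine hF.measurable.comp (measurable_pi_lambda _ fun i => ?_)
    exact measurable_subtype_coe.comp
      ((AddCircle.measurableEquivIoc (2 * π) (-π)).measurable.comp (measurable_pi_apply i))
  · have h : ∀ i, ∃ n : ℤ,
        ((AddCircle.equivIoc (2 * π) (-π) (torusMk ι y i) : ℝ)) = y i + 2 * π * n := by
      intro i
      have h := AddCircle.coe_equivIoc (p := 2 * π) (a := -π) (y := torusMk ι y i)
      obtain ⟨n, hn⟩ := AddCircle.coe_eq_zero_iff (2 * π) |>.1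
        ((AddCircle.coe_sub (2 * π) _ (y i)).trans (sub_eq_zero.2 h))
      refine ⟨n, ?_⟩
      rw [zsmul_eq_mul] at hn
      linarith
    choose n hn using h
    simp only [hn, hper]

theorem volume_torus_univ (n : ℕ) :
    volume (Set.univ : Set (Fin n → AddCircle (2 * π))) = ENNReal.ofReal (2 * π) ^ n := by
  rw [← Set.pi_univ Set.univ, volume_pi_pi]
  simp

/-- The homomorphism of tori induced by an integer matrix. -/
def torusHom {m n : ℕ} (M : Fin m → Fin n → ℤ) :
    (Fin n → AddCircle (2 * π)) →+ (Fin m → AddCircle (2 * π)) where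
  toFun t i := ∑ j, M i j • t j
  map_zero' := by ext; simp
  map_add' s t := by ext; simp [Finset.sum_add_distrib]

theorem torusHom_torusMk {m n : ℕ} (M : Fin m → Fin n → ℤ) (x : Fin n → ℝ) :
    torusHom M (torusMk (Fin n) x) = torusMk (Fin m) fun i => ∑ j, M i j * x j := by
  ext i
  have h := map_sum (QuotientAddGroup.mk' (AddSubgroup.zmultiples (2 * π)))
    (fun j => (M i j : ℝ) * x j) Finset.univ
  simp only [← zsmul_eq_mul] at h ⊢
  exact h.symm

theorem continuous_torusHom {m n : ℕ} (M : Fin m → Fin n → ℤ) : Continuous (torusHom M) :=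
  by
  refine continuous_pi fun i => ?_
  change Continuous fun t : Fin n → AddCircle (2 * π) => ∑ j, M i j • t j
  fun_prop

/-- An integer matrix with a real right inverse preserves means of periodic functions. -/
theorem mean_comp_int_matrix {m n : ℕ} (M : Fin m → Fin n → ℤ)
    (hM : Function.Surjective fun (x : Fin n → ℝ) (i : Fin m) => ∑ j, (M i j : ℝ) * x j)
    {F : (Fin m → ℝ) → ℝ} (hF : Continuous F)
    (hper : ∀ (y : Fin m → ℝ) (p : Fin m → ℤ), F (fun i => y i + 2 * π * p i) = F y) :
    ((2 * π) ^ n)⁻¹ * ∫ x in fundDomain n, F (fun i => ∑ j, (M i j : ℝ) * x j) =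
      ((2 * π) ^ m)⁻¹ * ∫ y in fundDomain m, F y := by
  obtain ⟨g, hg, hgF⟩ := exists_measurable_torus_descent hF hper
  have hsurj : Function.Surjective (torusHom M) := fun t => by
    obtain ⟨y, rfl⟩ := torusMk_surjective _ t
    obtain ⟨x, rfl⟩ := hM y
    exact ⟨_, torusHom_torusMk M x⟩
  have hc : ∀ k : ℕ, ENNReal.ofReal (2 * π) ^ k ≠ 0 := fun k =>
    pow_ne_zero _ (by simpa using two_pi_pos)
  have hc' : ∀ k : ℕ, ENNReal.ofReal (2 * π) ^ k ≠ ⊤ := fun k =>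
    ENNReal.pow_ne_top ENNReal.ofReal_ne_top
  have haar : ∀ k : ℕ, ((ENNReal.ofReal (2 * π) ^ k)⁻¹ •
      (volume : Measure (Fin k → AddCircle (2 * π)))).IsAddHaarMeasure := fun k =>
    Measure.IsAddHaarMeasure.smul _ (ENNReal.inv_ne_zero.2 (hc' k)) (ENNReal.inv_ne_top.2 (hc k))
  have hpres := by
    have := haar m
    have := haar n
    refine AddMonoidHom.measurePreserving (continuous_torusHom M) hsurj
      (μ := (ENNReal.ofReal (2 * π) ^ n)⁻¹ • volume)
      (ν := (ENNReal.ofReal (2 * π) ^ m)⁻¹ • volume) ?_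
    simp only [Measure.smul_apply, volume_torus_univ, smul_eq_mul]
    rw [ENNReal.inv_mul_cancel (hc n) (hc' n), ENNReal.inv_mul_cancel (hc m) (hc' m)]
  have key : ∀ (k : ℕ) (f : (Fin k → AddCircle (2 * π)) → ℝ), Measurable f →
      ((2 * π) ^ k)⁻¹ * ∫ x in fundDomain k, f (torusMk (Fin k) x) =
        ∫ t, f t ∂((ENNReal.ofReal (2 * π) ^ k)⁻¹ • volume) := by
    intro k f hf
    have hQ := measurePreserving_torusMk k
    rw [integral_smul_measure, ← hQ.map_eq,
      integral_map hQ.measurable.aemeasurable hf.aestronglyMeasurable]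
    rw [ENNReal.toReal_inv, ENNReal.toReal_pow, ENNReal.toReal_ofReal two_pi_pos.le, smul_eq_mul]
  have e1 := key n (g ∘ torusHom M) (hg.comp (continuous_torusHom M).measurable)
  have e2 := key m g hg
  rw [← hpres.map_eq, integral_map hpres.measurable.aemeasurable hg.aestronglyMeasurable] at e2
  simp only [Function.comp_apply, torusHom_torusMk, hgF] at e1 e2
  rw [e1, e2]

/-- **Normalization of Mikado flows on the torus.** If the profile `φ` has mean square one,
`(2π)^{-(d-1)} ∫_{[-π,π]^{d-1}} φ² = 1`, then `φ_{(k)}(x) = φ(λN_Λ k₁·x, …, λN_Λ k_{d-1}·x)`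
also has mean square one on `𝕋^d`, and hence `⨍_{𝕋^d} W_{(k)} ⊗ W_{(k)} = k ⊗ k` for the
Mikado flow `W_{(k)} = φ_{(k)} k`. -/
theorem mikado_normalization
    (d : ℕ) (hd : 2 ≤ d) (NΛ : ℕ) (hNΛ : 0 < NΛ)
    (k : Fin d → ℝ) (kv : Fin (d - 1) → Fin d → ℝ)
    -- `{k, k₁, …, k_{d-1}}` is an orthonormal basis of `ℝ^d`
    (hkk : dotProd k k = 1)
    (hkv : ∀ i j, dotProd (kv i) (kv j) = if i = j then 1 else 0)
    (hkkv : ∀ i, dotProd k (kv i) = 0)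
    -- `N_Λ k, N_Λ k₁, …, N_Λ k_{d-1} ∈ ℤ^d`
    (hkZ : ∀ i, ∃ z : ℤ, (NΛ : ℝ) * k i = z)
    (hkvZ : ∀ j i, ∃ z : ℤ, (NΛ : ℝ) * kv j i = z)
    (φ : (Fin (d - 1) → ℝ) → ℝ)
    (hφcont : Continuous φ)
    -- `(2πℤ)^{d-1}`-periodicity
    (hφper : ∀ (y : Fin (d - 1) → ℝ) (n : Fin (d - 1) → ℤ),
      φ (fun i => y i + 2 * π * n i) = φ y)
    -- normalization `(2π)^{-(d-1)} ∫_{[-π,π]^{d-1}} φ² = 1`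
    (hφnorm : ((2 * π) ^ (d - 1))⁻¹ * ∫ y in fundDomain (d - 1), (φ y) ^ 2 = 1)
    (lam : ℕ) (hlam : 0 < lam) :
    (((2 * π) ^ d)⁻¹ *
        ∫ x in fundDomain d, (φ fun i => ((lam : ℝ) * NΛ) * dotProd (kv i) x) ^ 2) = 1 ∧
    ∀ i j : Fin d,
      (((2 * π) ^ d)⁻¹ *
          ∫ x in fundDomain d,
            ((φ fun i' => ((lam : ℝ) * NΛ) * dotProd (kv i') x) * k i) *
              ((φ fun i' => ((lam : ℝ) * NΛ) * dotProd (kv i') x) * k j)) = k i * k j := by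
  choose z hz using hkvZ
  have hL : (0 : ℝ) < lam * NΛ := by positivity
  have hM : ∀ (x : Fin d → ℝ) (i : Fin (d - 1)),
      ((lam : ℝ) * NΛ) * dotProd (kv i) x = ∑ j, ((lam * z i j : ℤ) : ℝ) * x j := by
    intro x i
    rw [dotProd, Finset.mul_sum]
    refine Finset.sum_congr rfl fun j _ => ?_
    push_cast
    rw [← hz i j]
    ring
  have hsurj : Function.Surjective fun (x : Fin d → ℝ) (i : Fin (d - 1)) =>
      ∑ j, ((lam * z i j : ℤ) : ℝ) * x j := by
    intro y
    refine ⟨fun j => ∑ l, y l / (lam * NΛ) * kv l j, funext fun i => ?_⟩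
    have h : dotProd (kv i) (fun j => ∑ l, y l / (lam * NΛ) * kv l j) = y i / (lam * NΛ) := by
      calc dotProd (kv i) (fun j => ∑ l, y l / (lam * NΛ) * kv l j)
          = ∑ l, y l / (lam * NΛ) * dotProd (kv i) (kv l) := by
            simp only [dotProd, Finset.mul_sum]
            rw [Finset.sum_comm]
            exact Finset.sum_congr rfl fun _ _ => Finset.sum_congr rfl fun _ _ => by ring
        _ = y i / (lam * NΛ) := by simp [hkv]
    dsimp only
    rw [← hM, h, mul_div_cancel₀ _ hL.ne']
  have main : (((2 * π) ^ d)⁻¹ *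
      ∫ x in fundDomain d, (φ fun i => ((lam : ℝ) * NΛ) * dotProd (kv i) x) ^ 2) = 1 := by
    simp only [hM]
    exact (mean_comp_int_matrix (fun i j => lam * z i j) hsurj (F := fun y => φ y ^ 2)
      (hφcont.pow 2) fun y p => by simp only [hφper]).trans hφnorm
  refine ⟨main, fun i j => ?_⟩
  have h : ∀ a : ℝ, a * k i * (a * k j) = a ^ 2 * (k i * k j) := fun a => by ring
  simp only [h]
  rw [integral_mul_const, ← mul_assoc, main, one_mul]

end
end

section
/- (L^p decorrelation) Let N ≥ 1 be an integer, let 𝕋^N := ℝ^N/ℤ^N be the unit torus with its unit-volume Lebesgue measure, and let f, g : 𝕋^N → ℝ be smooth. Then for every σ ∈ ℕ₊ and every p ∈ [1,∞], | ‖ f · g(σ ·) ‖_{L^p(𝕋^N)} − ‖f‖_{L^p(𝕋^N)} ‖g‖_{L^p(𝕋^N)} | ≤ C σ^{−1/p} ‖f‖_{C¹(𝕋^N)} ‖g‖_{L^p(𝕋^N)}, where g(σ·) denotes the function x ↦ g(σ x) (well defined on 𝕋^N since σ ∈ ℕ), ‖f‖_{C¹} := sup|f| + sup|∇f|, and C is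 a constant depending only on N and p (independent of f, g and σ). -/
open Real MeasureTheory
open scoped ENNReal

noncomputable section

section Torus

/-- Lebesgue measure on the unit cube, a fundamental domain of `ℤ^N`. -/
local notation "cubeMeasure" N => (volume.restrict (Set.univ.pi fun _ : Fin N => Set.Ioc (0 : ℝ) 1))

variable {N : ℕ}

/-- Invariance under integer translations. -/
def IntPeriodic {β : Type*} (f : (Fin N → ℝ) → β) : Prop :=
  ∀ (x : Fin N → ℝ) (n : Fin N → ℤ), f (fun i => x i + n i) = f x

theorem IntPeriodic.comp_left {β γ : Type*} {f : (Fin N → ℝ) → β} (hf : IntPeriodic f)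
    (F : β → γ) : IntPeriodic fun x => F (f x) :=
  fun x n => congrArg F (hf x n)

instance : Countable
    (Submodule.span ℤ (Set.range (Pi.basisFun ℝ (Fin N)))).toAddSubgroup :=
  inferInstanceAs (Countable (Submodule.span ℤ (Set.range (Pi.basisFun ℝ (Fin N)))))

theorem restrict_Ioc_eq_fundamentalDomain :
    (cubeMeasure N) = volume.restrict (ZSpan.fundamentalDomain (Pi.basisFun ℝ (Fin N))) := by
  rw [ZSpan.fundamentalDomain_pi_basisFun]
  exact Measure.restrict_congr_set
    (Measure.univ_pi_Ioc_ae_eq_Icc.trans Measure.univ_pi_Ico_ae_eq_Icc.symm)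

theorem IntPeriodic.vadd {β : Type*} {f : (Fin N → ℝ) → β} (hf : IntPeriodic f)
    (n : (Submodule.span ℤ (Set.range (Pi.basisFun ℝ (Fin N)))).toAddSubgroup) (x : Fin N → ℝ) :
    f (n +ᵥ x) = f x := by
  have h := ((Pi.basisFun ℝ (Fin N)).mem_span_iff_repr_mem ℤ (n : Fin N → ℝ)).1 n.2
  choose m hm using h
  rw [← hf x m]
  congr 1
  ext i
  have := hm i
  simp at this
  simp [AddSubgroup.vadd_def, this, add_comm]

open scoped Pointwise in
theorem IntPeriodic.integral_add {f : (Fin N → ℝ) → ℝ} (hf : IntPeriodic f) (v : Fin N → ℝ) :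
    ∫ x, f (x + v) ∂(cubeMeasure N) = ∫ x, f x ∂(cubeMeasure N) := by
  rw [restrict_Ioc_eq_fundamentalDomain]
  set b := Pi.basisFun ℝ (Fin N)
  have hD := ZSpan.isAddFundamentalDomain' b volume
  have hmp : MeasurePreserving (fun x : Fin N → ℝ => x + v) volume volume :=
    measurePreserving_add_right volume v
  have := hmp.setIntegral_image_emb (measurableEmbedding_addRight v) f
    (ZSpan.fundamentalDomain b)
  rw [← this]
  have himg : (fun x : Fin N → ℝ => x + v) '' ZSpan.fundamentalDomain b
      = v +ᵥ ZSpan.fundamentalDomain b := by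
    rw [← Set.image_vadd]
    simp only [vadd_eq_add, add_comm]
  rw [himg]
  exact (hD.vadd_of_comm v).setIntegral_eq hD (fun n x => hf.vadd n x)

theorem integrable_prod_cube {F : (Fin N → ℝ) × (Fin N → ℝ) → ℝ} (hF : Continuous F) :
    Integrable F ((cubeMeasure N).prod (cubeMeasure N)) := by
  rw [Measure.prod_restrict]
  refine IntegrableOn.mono_set (hF.continuousOn.integrableOn_compact
    ((isCompact_univ_pi fun _ => isCompact_Icc).prod (isCompact_univ_pi fun _ => isCompact_Icc)))
    (Set.prod_mono (Set.pi_mono fun _ _ => Set.Ioc_subset_Icc_self)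
      (Set.pi_mono fun _ _ => Set.Ioc_subset_Icc_self))

instance : IsProbabilityMeasure (cubeMeasure N) := by
  constructor
  simp [Real.volume_pi_Ioc]

theorem abs_integral_mul_comp_smul_sub_le {φ h : (Fin N → ℝ) → ℝ} (hφc : Continuous φ)
    (hhc : Continuous h) (hφ : IntPeriodic φ) (hh : IntPeriodic h) (h0 : ∀ x, 0 ≤ h x) {L : ℝ}
    (hL : ∀ x y, |φ x - φ y| ≤ L * ‖x - y‖) (hL0 : 0 ≤ L) {σ : ℕ} (hσ : 0 < σ) :
    |(∫ x, φ x * h (fun i => (σ : ℝ) * x i) ∂(cubeMeasure N)) -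
        (∫ x, φ x ∂(cubeMeasure N)) * ∫ x, h x ∂(cubeMeasure N)| ≤
      L / σ * ∫ x, h x ∂(cubeMeasure N) := by
  have hσ' : (0 : ℝ) < σ := Nat.cast_pos.2 hσ
  set μ := cubeMeasure N
  set s : (Fin N → ℝ) × (Fin N → ℝ) → (Fin N → ℝ) := fun z => (σ : ℝ) • z.1 + z.2
  have hs : Continuous s := by fun_prop
  set t : (Fin N → ℝ) × (Fin N → ℝ) → (Fin N → ℝ) := fun z => z.1 + (σ : ℝ)⁻¹ • z.2
  have ht : Continuous t := by fun_prop
  have iA : Integrable (fun z => φ (t z) * h (s z)) (μ.prod μ) :=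
    integrable_prod_cube (by fun_prop)
  have iB : Integrable (fun z => φ z.1 * h (s z)) (μ.prod μ) :=
    integrable_prod_cube (by fun_prop)
  have iG : Integrable (fun z => h (s z)) (μ.prod μ) :=
    integrable_prod_cube (by fun_prop)
  have inner (x : Fin N → ℝ) : ∫ u, h (s (x, u)) ∂μ = ∫ u, h u ∂μ := by
    simp only [s, add_comm ((σ : ℝ) • x)]
    exact hh.integral_add _
  have eA : ∫ z, φ (t z) * h (s z) ∂(μ.prod μ)
      = ∫ x, φ x * h (fun i => (σ : ℝ) * x i) ∂μ := by
    rw [integral_prod_symm _ iA]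
    have hper : IntPeriodic fun x => φ x * h (fun i => (σ : ℝ) * x i) := by
      intro x n
      have := hh (fun i => (σ : ℝ) * x i) (fun i => σ * n i)
      push_cast at this
      simp only [mul_add, hφ x n, this]
    have (u : Fin N → ℝ) : ∫ x, φ (t (x, u)) * h (s (x, u)) ∂μ
        = ∫ x, φ x * h (fun i => (σ : ℝ) * x i) ∂μ := by
      rw [← hper.integral_add ((σ : ℝ)⁻¹ • u)]
      congr 1 with x
      congr 2
      ext i
      simp [s]
      field_simp
    simp [this]
  have eB : ∫ z, φ z.1 * h (s z) ∂(μ.prod μ) = (∫ x, φ x ∂μ) * ∫ x, h x ∂μ := by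
    rw [integral_prod _ iB]
    simp only [integral_const_mul, inner, integral_mul_const]
  have eG : ∫ z, h (s z) ∂(μ.prod μ) = ∫ x, h x ∂μ := by
    rw [integral_prod _ iG]
    simp [inner]
  rw [← eA, ← eB, ← eG, ← integral_sub iA iB, ← integral_const_mul,
    ← Real.norm_eq_abs]
  refine norm_integral_le_of_norm_le (iG.const_mul _) ?_
  have hmem : ∀ᵐ z ∂(μ.prod μ), z ∈ (Set.univ.pi fun _ : Fin N => Set.Ioc (0 : ℝ) 1) ×ˢ
      (Set.univ.pi fun _ : Fin N => Set.Ioc (0 : ℝ) 1) := by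
    simp only [μ, Measure.prod_restrict]
    exact ae_restrict_mem (.prod (.univ_pi fun _ => measurableSet_Ioc)
      (.univ_pi fun _ => measurableSet_Ioc))
  filter_upwards [hmem] with z hz
  have hz2 : ‖z.2‖ ≤ 1 := by
    rw [pi_norm_le_iff_of_nonneg zero_le_one]
    intro i
    have := hz.2 i trivial
    rw [Real.norm_of_nonneg this.1.le]
    exact this.2
  rw [← sub_mul, norm_mul, Real.norm_of_nonneg (h0 _)]
  refine mul_le_mul_of_nonneg_right ((hL _ _).trans ?_) (h0 _)
  rw [div_eq_mul_inv]
  gcongr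
  simp only [t, add_sub_cancel_left, norm_smul, norm_inv, RCLike.norm_natCast]
  exact mul_le_of_le_one_right (by positivity) hz2

theorem IntPeriodic.bddAbove_range {f : (Fin N → ℝ) → ℝ} (hf : IntPeriodic f)
    (hc : Continuous f) : BddAbove (Set.range f) := by
  have hK : IsCompact (Set.univ.pi fun _ : Fin N => Set.Icc (0 : ℝ) 1) :=
    isCompact_univ_pi fun _ => isCompact_Icc
  refine (hK.bddAbove_image hc.continuousOn).mono ?_
  rintro _ ⟨x, rfl⟩
  refine ⟨fun i => Int.fract (x i), fun i _ => ⟨Int.fract_nonneg _, (Int.fract_lt_one _).le⟩, ?_⟩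
  rw [← hf _ fun i => ⌊x i⌋]
  simp

theorem IntPeriodic.fderiv {f : (Fin N → ℝ) → ℝ} (hf : IntPeriodic f) :
    IntPeriodic (fderiv ℝ f) := by
  intro x n
  have h : (fun y => f (y + fun i => (n i : ℝ))) = f := funext fun y => hf y n
  conv_rhs => rw [← h]
  exact (fderiv_comp_add_right (fun i => (n i : ℝ))).symm

theorem abs_rpow_abs_sub_rpow_abs_le {p M a b : ℝ} (hp : 1 ≤ p) (ha : |a| ≤ M) (hb : |b| ≤ M) :
    |(|a| ^ p - |b| ^ p)| ≤ p * M ^ (p - 1) * |a - b| := by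
  have h := Convex.norm_image_sub_le_of_norm_hasDerivWithin_le (f := fun x : ℝ => x ^ p)
    (f' := fun x => p * x ^ (p - 1)) (s := Set.Icc 0 M) (C := p * M ^ (p - 1)) (x := |b|) (y := |a|)
    (fun x _ => (Real.hasDerivAt_rpow_const (Or.inr hp)).hasDerivWithinAt)
    (fun x hx => by
      rw [Real.norm_of_nonneg (by have := hx.1; positivity)]
      have := hx.1
      have := hx.2
      gcongr) (convex_Icc 0 M) ⟨abs_nonneg _, hb⟩ ⟨abs_nonneg _, ha⟩
  refine h.trans ?_
  have : 0 ≤ M := (abs_nonneg a).trans ha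
  gcongr
  exact abs_abs_sub_abs_le a b

theorem abs_rpow_sub_rpow_le {q a b : ℝ} (hq : 0 ≤ q) (hq1 : q ≤ 1) (ha : 0 ≤ a) (hb : 0 ≤ b) :
    |a ^ q - b ^ q| ≤ |a - b| ^ q := by
  wlog hab : b ≤ a generalizing a b
  · rw [abs_sub_comm, abs_sub_comm a]
    exact this hb ha (le_of_not_ge hab)
  rw [abs_of_nonneg (sub_nonneg.2 (by gcongr)), abs_of_nonneg (sub_nonneg.2 hab)]
  have := Real.rpow_add_le_add_rpow (sub_nonneg.2 hab) hb hq hq1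
  rw [sub_add_cancel] at this
  linarith

theorem toReal_eLpNorm_cube {f : (Fin N → ℝ) → ℝ} (hf : Continuous f) {p : ℝ≥0∞} (hp : 1 ≤ p)
    (hp' : p ≠ ∞) :
    (eLpNorm f p (cubeMeasure N)).toReal
      = (∫ x, |f x| ^ p.toReal ∂(cubeMeasure N)) ^ p.toReal⁻¹ := by
  rw [toReal_eLpNorm hf.aestronglyMeasurable,
    lpNorm_eq_integral_norm_rpow_toReal (by positivity) hp' hf.aestronglyMeasurable]
  rfl

theorem IntPeriodic.enorm_le_eLpNorm_top {g : (Fin N → ℝ) → ℝ} (hg : IntPeriodic g)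
    (hc : Continuous g) (x : Fin N → ℝ) : ‖g x‖ₑ ≤ eLpNorm g ∞ (cubeMeasure N) := by
  have hess : eLpNorm g ∞ (cubeMeasure N) = essSup (fun x => ‖g x‖ₑ) volume := by
    rw [eLpNorm_exponent_top, eLpNormEssSup_eq_essSup_enorm, restrict_Ioc_eq_fundamentalDomain]
    exact (ZSpan.isAddFundamentalDomain' (Pi.basisFun ℝ (Fin N)) volume).essSup_measure_restrict
      fun n x => by rw [hg.vadd]
  have hopen : IsOpen {y | essSup (fun x => ‖g x‖ₑ) volume < ‖g y‖ₑ} :=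
    isOpen_lt continuous_const hc.enorm
  have hnull := meas_essSup_lt (f := fun x => ‖g x‖ₑ) (μ := (volume : Measure (Fin N → ℝ)))
  rw [hopen.measure_eq_zero_iff (volume : Measure (Fin N → ℝ))] at hnull
  rw [hess]
  by_contra! hlt
  exact Set.notMem_empty x (hnull ▸ hlt)

theorem IntPeriodic.abs_sub_le {f : (Fin N → ℝ) → ℝ} (hf : IntPeriodic f) (hfs : ContDiff ℝ 1 f)
    (x y : Fin N → ℝ) : |f x - f y| ≤ (⨆ z, ‖_root_.fderiv ℝ f z‖) * ‖x - y‖ := by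
  have hb : BddAbove (Set.range fun z => ‖_root_.fderiv ℝ f z‖) :=
    (hf.fderiv.comp_left norm).bddAbove_range (hfs.continuous_fderiv one_ne_zero).norm
  exact convex_univ.norm_image_sub_le_of_norm_fderiv_le
    (fun z _ => (hfs.differentiable one_ne_zero) z) (fun z _ => le_ciSup hb z) trivial trivial

theorem Lp_decorrelation_top {f g : (Fin N → ℝ) → ℝ} (hfc : Continuous f) (hgc : Continuous g)
    (hf : IntPeriodic f) (hg : IntPeriodic g) (c : ℝ) :
    |(eLpNorm (fun x => f x * g fun i => c * x i) ∞ (cubeMeasure N)).toReal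
        - (eLpNorm f ∞ (cubeMeasure N)).toReal * (eLpNorm g ∞ (cubeMeasure N)).toReal|
      ≤ (⨆ x, |f x|) * (eLpNorm g ∞ (cubeMeasure N)).toReal := by
  have bound {u : (Fin N → ℝ) → ℝ} {B : ℝ} (hB : ∀ x, |u x| ≤ B) :
      eLpNorm u ∞ (cubeMeasure N) ≤ ENNReal.ofReal B := by
    simpa using eLpNorm_le_of_ae_bound (p := ∞) (μ := cubeMeasure N) (.of_forall hB)
  have hfb := (hf.comp_left abs).bddAbove_range hfc.abs
  have hgb := (hg.comp_left abs).bddAbove_range hgc.abs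
  have hM (x) : |f x| ≤ ⨆ x, |f x| := le_ciSup hfb x
  have hM0 : 0 ≤ ⨆ x, |f x| := (abs_nonneg _).trans (hM 0)
  have hgtop : eLpNorm g ∞ (cubeMeasure N) ≠ ∞ :=
    ((bound fun x => le_ciSup hgb x).trans_lt ENNReal.ofReal_lt_top).ne
  have hB (x) : |g x| ≤ (eLpNorm g ∞ (cubeMeasure N)).toReal := by
    have := ENNReal.toReal_mono hgtop (hg.enorm_le_eLpNorm_top hgc x)
    simpa using this
  set M := ⨆ x, |f x|
  set B := (eLpNorm g ∞ (cubeMeasure N)).toReal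
  have hB0 : 0 ≤ B := ENNReal.toReal_nonneg
  have h1 : (eLpNorm f ∞ (cubeMeasure N)).toReal ≤ M := ENNReal.toReal_le_of_le_ofReal hM0 (bound hM)
  have h2 : (eLpNorm (fun x => f x * g fun i => c * x i) ∞ (cubeMeasure N)).toReal ≤ M * B := by
    refine ENNReal.toReal_le_of_le_ofReal (by positivity) (bound fun x => ?_)
    rw [abs_mul]
    exact mul_le_mul (hM _) (hB _) (abs_nonneg _) hM0
  exact abs_sub_le_of_nonneg_of_le ENNReal.toReal_nonneg h2 (by positivity) (by gcongr)

theorem Lp_decorrelation_of_ne_top {f g : (Fin N → ℝ) → ℝ} (hfs : ContDiff ℝ 1 f)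
    (hgc : Continuous g) (hf : IntPeriodic f) (hg : IntPeriodic g) {p : ℝ≥0∞} (hp : 1 ≤ p)
    (hp' : p ≠ ∞) {σ : ℕ} (hσ : 0 < σ) :
    |(eLpNorm (fun x => f x * g fun i => (σ : ℝ) * x i) p (cubeMeasure N)).toReal
        - (eLpNorm f p (cubeMeasure N)).toReal * (eLpNorm g p (cubeMeasure N)).toReal|
      ≤ p.toReal ^ p.toReal⁻¹ * (σ : ℝ) ^ (-p.toReal⁻¹) *
        ((⨆ x, |f x|) + ⨆ x, ‖fderiv ℝ f x‖) * (eLpNorm g p (cubeMeasure N)).toReal := by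
  have hfc := hfs.continuous
  have hr : 1 ≤ p.toReal := by simpa using ENNReal.toReal_mono hp' hp
  rw [toReal_eLpNorm_cube (by fun_prop) hp hp', toReal_eLpNorm_cube hfc hp hp',
    toReal_eLpNorm_cube hgc hp hp']
  set r := p.toReal
  have hr0 : 0 < r := by linarith
  have hfb := (hf.comp_left abs).bddAbove_range hfc.abs
  have hD0 : 0 ≤ ⨆ x, ‖fderiv ℝ f x‖ := Real.iSup_nonneg fun _ => norm_nonneg _
  have hS0 : 0 ≤ ⨆ x, |f x| := Real.iSup_nonneg fun _ => abs_nonneg _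
  set M := (⨆ x, |f x|) + ⨆ x, ‖fderiv ℝ f x‖
  have hM0 : 0 ≤ M := by positivity
  have hM (x) : |f x| ≤ M := (le_ciSup hfb x).trans (le_add_of_nonneg_right hD0)
  have hL (x y) : |(|f x| ^ r - |f y| ^ r)| ≤ (r * M ^ r) * ‖x - y‖ := calc
    _ ≤ r * M ^ (r - 1) * |f x - f y| := abs_rpow_abs_sub_rpow_abs_le hr (hM x) (hM y)
    _ ≤ r * M ^ (r - 1) * (M * ‖x - y‖) := by
      gcongr
      exact (hf.abs_sub_le hfs x y).trans (by gcongr; exact le_add_of_nonneg_left hS0)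
    _ = (r * M ^ r) * ‖x - y‖ := by
      have : M ^ r = M ^ (r - 1) * M := by
        rw [← Real.rpow_add_one' hM0 (by linarith), sub_add_cancel]
      rw [this]; ring
  have key := abs_integral_mul_comp_smul_sub_le (φ := fun x => |f x| ^ r) (h := fun x => |g x| ^ r)
    (hfc.abs.rpow_const fun _ => .inr hr0.le) (hgc.abs.rpow_const fun _ => .inr hr0.le)
    (hf.comp_left fun y => |y| ^ r) (hg.comp_left fun y => |y| ^ r)
    (fun x => by positivity) hL (by positivity) hσ
  simp only [← Real.mul_rpow (abs_nonneg _) (abs_nonneg _), ← abs_mul] at key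
  have hF0 : 0 ≤ ∫ x, |f x| ^ r ∂(cubeMeasure N) := integral_nonneg fun _ => by positivity
  have hG0 : 0 ≤ ∫ x, |g x| ^ r ∂(cubeMeasure N) := integral_nonneg fun _ => by positivity
  have hA0 : 0 ≤ ∫ x, |f x * g fun i => (σ : ℝ) * x i| ^ r ∂(cubeMeasure N) :=
    integral_nonneg fun _ => by positivity
  rw [← Real.mul_rpow hF0 hG0]
  refine (abs_rpow_sub_rpow_le (by positivity) (inv_le_one_of_one_le₀ hr) hA0
    (by positivity)).trans ((Real.rpow_le_rpow (abs_nonneg _) key (by positivity)).trans_eq ?_)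
  rw [Real.mul_rpow (by positivity) hG0, Real.div_rpow (by positivity) (by positivity),
    Real.mul_rpow hr0.le (by positivity), Real.rpow_rpow_inv hM0 hr0.ne',
    Real.rpow_neg (by positivity)]
  ring

end Torus

/-- **`L^p` decorrelation.** For smooth functions `f, g` on the unit torus `𝕋^N` and
`σ ∈ ℕ₊`, `| ‖f · g(σ·)‖_{L^p} - ‖f‖_{L^p} ‖g‖_{L^p} | ≤ C σ^{-1/p} ‖f‖_{C¹} ‖g‖_{L^p}`,
with a constant `C` depending only on `N` and `p`. -/
theorem Lp_decorrelation (N : ℕ) (hN : 1 ≤ N) (p : ℝ≥0∞) (hp : 1 ≤ p) :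
    ∃ C : ℝ, 0 < C ∧
      ∀ f g : (Fin N → ℝ) → ℝ,
        ContDiff ℝ (⊤ : ℕ∞) f → ContDiff ℝ (⊤ : ℕ∞) g →
        -- `f` and `g` are `ℤ^N`-periodic, i.e. functions on the unit torus `𝕋^N = ℝ^N/ℤ^N`
        (∀ (x : Fin N → ℝ) (n : Fin N → ℤ), f (fun i => x i + n i) = f x) →
        (∀ (x : Fin N → ℝ) (n : Fin N → ℤ), g (fun i => x i + n i) = g x) →
        ∀ σ : ℕ, 0 < σ →
          |(eLpNorm (fun x => f x * g fun i => (σ : ℝ) * x i) p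
                (volume.restrict (Set.univ.pi fun _ : Fin N => Set.Ioc (0 : ℝ) 1))).toReal
              - (eLpNorm f p
                  (volume.restrict (Set.univ.pi fun _ : Fin N => Set.Ioc (0 : ℝ) 1))).toReal *
                (eLpNorm g p
                  (volume.restrict (Set.univ.pi fun _ : Fin N => Set.Ioc (0 : ℝ) 1))).toReal|
            ≤ C * (σ : ℝ) ^ (-p.toReal⁻¹) *
                ((⨆ x : Fin N → ℝ, |f x|) + ⨆ x : Fin N → ℝ, ‖fderiv ℝ f x‖) *
                (eLpNorm g p
                  (volume.restrict (Set.univ.pi fun _ : Fin N => Set.Ioc (0 : ℝ) 1))).toReal := by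
  rcases eq_or_ne p ∞ with rfl | hp'
  · refine ⟨1, one_pos, fun f g hf hg hfp hgp σ _ => ?_⟩
    refine (Lp_decorrelation_top hf.continuous hg.continuous hfp hgp σ).trans ?_
    simp only [ENNReal.toReal_top, inv_zero, neg_zero, Real.rpow_zero, one_mul]
    gcongr
    exact le_add_of_nonneg_right (Real.iSup_nonneg fun _ => norm_nonneg _)
  · have hr : 0 < p.toReal := ENNReal.toReal_pos (by positivity) hp'
    exact ⟨p.toReal ^ p.toReal⁻¹, by positivity, fun f g hf hg hfp hgp σ hσ =>
      Lp_decorrelation_of_ne_top (hf.of_le (by exact_mod_cast le_top)) hg.continuous hfp hgp hp hp'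
        hσ⟩

end
end
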